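/- arXiv:1602.06765 — 12 statements merged into one kernel-verified Lean document; each statement's English description precedes it below -/
import Mathlib

section
/- The quartic equation Φ1(α)Φ2(α) − λ1λ2 = 0 has exactly four real solutions. More precisely: b₀² − 4a₀c₀ > 0, the quadratic a₀ζ² + b₀ζ + c₀ = 0 has two distinct real roots β1 > β2 > 0, and the set of real α with Φ1(α)Φ2(α) = λ1λ2 is exactly {−√β1, −√β2, √β2, √β1}; in particular Φ1(α)Φ2(α) − λ1λ2 = a₀α⁴ + b₀α² + c₀ for all real α. -/
/-- A real quadratic with coefficients of signs `+, -, +` and positive discriminant factors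
with two distinct positive roots. -/
theorem exists_pos_roots_of_discrim_pos {a b c : ℝ} (ha : 0 < a) (hb : b < 0) (hc : 0 < c)
    (hd : 0 < b ^ 2 - 4 * a * c) :
    ∃ r s : ℝ, 0 < s ∧ s < r ∧ ∀ x, a * x ^ 2 + b * x + c = a * ((x - r) * (x - s)) := by
  have hD := Real.sqrt_pos.2 hd
  have hDsq := Real.sq_sqrt hd.le
  set D := Real.sqrt (b ^ 2 - 4 * a * c)
  have hac : 0 < a * c := mul_pos ha hc
  have hDb : D < -b := by nlinarith
  refine ⟨(-b + D) / (2 * a), (-b - D) / (2 * a), by apply div_pos <;> linarith, ?_, fun x => ?_⟩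
  · gcongr
    linarith
  · field_simp
    linear_combination hDsq

theorem sq_eq_iff_eq_sqrt_or_eq_neg_sqrt {x r : ℝ} (hr : 0 ≤ r) :
    x ^ 2 = r ↔ x = Real.sqrt r ∨ x = -Real.sqrt r := by
  rw [← sq_eq_sq_iff_eq_or_eq_neg, Real.sq_sqrt hr]

/-- The quartic equation Φ1(α)Φ2(α) − lam1lam2 = 0 has exactly four real
solutions: b₀² − 4a₀c₀ > 0, the quadratic a₀ζ² + b₀ζ + c₀ = 0 has two distinct
positive roots β1 > β2 > 0, the solution set of the quartic is
{−√β1, −√β2, √β2, √β1}, and Φ1(α)Φ2(α) − lam1lam2 = a₀α⁴ + b₀α² + c₀ for all α. -/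
theorem stmt_0 (ρ lam1 lam2 σ1 σ2 : ℝ)
    (hρ : 0 < ρ) (hlam1 : 0 < lam1) (hlam2 : 0 < lam2) (hσ1 : 0 < σ1) (hσ2 : 0 < σ2)
    (Φ1 Φ2 : ℝ → ℝ)
    (hΦ1 : ∀ α : ℝ, Φ1 α = -(1/2) * σ1^2 * α^2 + ρ + lam1)
    (hΦ2 : ∀ α : ℝ, Φ2 α = -(1/2) * σ2^2 * α^2 + ρ + lam2)
    (a₀ b₀ c₀ : ℝ)
    (ha₀ : a₀ = (1/4) * σ1^2 * σ2^2)
    (hb₀ : b₀ = -(1/2) * σ1^2 * (ρ + lam2) - (1/2) * σ2^2 * (ρ + lam1))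
    (hc₀ : c₀ = (ρ + lam1) * (ρ + lam2) - lam1 * lam2) :
    b₀^2 - 4 * a₀ * c₀ > 0 ∧
    ∃ β1 β2 : ℝ, 0 < β2 ∧ β2 < β1 ∧
      a₀ * β1^2 + b₀ * β1 + c₀ = 0 ∧
      a₀ * β2^2 + b₀ * β2 + c₀ = 0 ∧
      {α : ℝ | Φ1 α * Φ2 α = lam1 * lam2} =
        {-Real.sqrt β1, -Real.sqrt β2, Real.sqrt β2, Real.sqrt β1} ∧
      ∀ α : ℝ, Φ1 α * Φ2 α - lam1 * lam2 = a₀ * α^4 + b₀ * α^2 + c₀ := by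
  have hquartic : ∀ α : ℝ, Φ1 α * Φ2 α - lam1 * lam2 = a₀ * α^4 + b₀ * α^2 + c₀ := by
    intro α
    rw [hΦ1, hΦ2, ha₀, hb₀, hc₀]
    ring
  have ha : 0 < a₀ := by rw [ha₀]; positivity
  have hb : b₀ < 0 := by
    have h1 : 0 < σ1 ^ 2 * (ρ + lam2) := by positivity
    have h2 : 0 < σ2 ^ 2 * (ρ + lam1) := by positivity
    linarith
  have hc : 0 < c₀ := by
    have h : c₀ = ρ * (ρ + lam1 + lam2) := by rw [hc₀]; ring
    rw [h]
    positivity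
  have hd : 0 < b₀ ^ 2 - 4 * a₀ * c₀ := by
    have h : b₀ ^ 2 - 4 * a₀ * c₀ =
        (σ1 ^ 2 * (ρ + lam2) / 2 - σ2 ^ 2 * (ρ + lam1) / 2) ^ 2
          + σ1 ^ 2 * σ2 ^ 2 * (lam1 * lam2) := by
      rw [ha₀, hb₀, hc₀]
      ring
    rw [h]
    positivity
  obtain ⟨β1, β2, hβ2, hlt, hfac⟩ := exists_pos_roots_of_discrim_pos ha hb hc hd
  refine ⟨hd, β1, β2, hβ2, hlt, by rw [hfac]; ring, by rw [hfac]; ring, ?_, hquartic⟩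
  ext α
  have hpow : a₀ * α ^ 4 + b₀ * α ^ 2 + c₀ = a₀ * ((α ^ 2 - β1) * (α ^ 2 - β2)) := by
    rw [← hfac]
    ring
  simp only [Set.mem_ofPred_eq, Set.mem_insert_iff, Set.mem_singleton_iff]
  rw [← sub_eq_zero, hquartic, hpow, mul_eq_zero_iff_left ha.ne', mul_eq_zero, sub_eq_zero,
    sub_eq_zero, sq_eq_iff_eq_sqrt_or_eq_neg_sqrt (hβ2.trans hlt).le,
    sq_eq_iff_eq_sqrt_or_eq_neg_sqrt hβ2.le]
  tauto
end

section
/- One has Φ1(α3) > 0 and Φ1(α4) < 0. -/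
/-- With α3 < α4 the two positive roots of Φ1(α)Φ2(α) − λ1λ2 = 0,
one has Φ1(α3) > 0 and Φ1(α4) < 0. -/
theorem stmt_1 (ρ lam1 lam2 σ1 σ2 : ℝ)
    (hρ : 0 < ρ) (hlam1 : 0 < lam1) (hlam2 : 0 < lam2) (hσ1 : 0 < σ1) (hσ2 : 0 < σ2)
    (Φ1 Φ2 : ℝ → ℝ)
    (hΦ1 : ∀ α : ℝ, Φ1 α = -(1/2) * σ1^2 * α^2 + ρ + lam1)
    (hΦ2 : ∀ α : ℝ, Φ2 α = -(1/2) * σ2^2 * α^2 + ρ + lam2)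
    (α3 α4 : ℝ) (hα3 : 0 < α3) (hα34 : α3 < α4)
    (hroot3 : Φ1 α3 * Φ2 α3 - lam1 * lam2 = 0)
    (hroot4 : Φ1 α4 * Φ2 α4 - lam1 * lam2 = 0) :
    Φ1 α3 > 0 ∧ Φ1 α4 < 0 := by
  have hsq : α3 ^ 2 < α4 ^ 2 := by gcongr
  have hanti1 : Φ1 α4 < Φ1 α3 := by
    rw [hΦ1, hΦ1]
    linarith [mul_lt_mul_of_pos_left hsq (pow_pos hσ1 2)]
  have hanti2 : Φ2 α4 < Φ2 α3 := by
    rw [hΦ2, hΦ2]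
    linarith [mul_lt_mul_of_pos_left hsq (pow_pos hσ2 2)]
  have hpos3 : 0 < Φ1 α3 * Φ2 α3 := by linarith [mul_pos hlam1 hlam2]
  have hpos4 : 0 < Φ1 α4 * Φ2 α4 := by linarith [mul_pos hlam1 hlam2]
  constructor
  · rcases pos_and_pos_or_neg_and_neg_of_mul_pos hpos3 with ⟨h1, -⟩ | ⟨h1, h2⟩
    · exact h1
    · nlinarith [mul_pos_of_neg_of_neg h1 (sub_neg.2 hanti2),
        mul_pos_of_neg_of_neg (sub_neg.2 hanti1) (hanti2.trans h2)]
  · rcases pos_and_pos_or_neg_and_neg_of_mul_pos hpos4 with ⟨h1, h2⟩ | ⟨h1, -⟩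
    · nlinarith [mul_pos h1 (sub_pos.2 hanti2),
        mul_pos (sub_pos.2 hanti1) (h2.trans hanti2)]
    · exact h1
end

section
/- The constants a1, a2, a3, a4 satisfy a1 < 0, a2 > 0, a3 < 0 and a4 > 0. -/
/-- The constants a1, a2, a3, a4 of the paper satisfy
a1 < 0, a2 > 0, a3 < 0 and a4 > 0. -/
theorem stmt_2 (ρ lam1 lam2 σ1 σ2 : ℝ)
    (hρ : 0 < ρ) (hlam1 : 0 < lam1) (hlam2 : 0 < lam2) (hσ1 : 0 < σ1) (hσ2 : 0 < σ2)
    (Φ1 Φ2 : ℝ → ℝ)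
    (hΦ1 : ∀ α : ℝ, Φ1 α = -(1/2) * σ1^2 * α^2 + ρ + lam1)
    (hΦ2 : ∀ α : ℝ, Φ2 α = -(1/2) * σ2^2 * α^2 + ρ + lam2)
    (α3 α4 : ℝ) (hα3 : 0 < α3) (hα34 : α3 < α4)
    (hroot3 : Φ1 α3 * Φ2 α3 - lam1 * lam2 = 0)
    (hroot4 : Φ1 α4 * Φ2 α4 - lam1 * lam2 = 0)
    (a1 a2 a3 a4 : ℝ)
    (ha1 : a1 = -(α4 * Φ1 α3 - α3 * Φ1 α4) / (lam1 * (α4 - α3)) + ρ / (ρ + lam2))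
    (ha2 : a2 = (Φ1 α3 - Φ1 α4) / (lam1 * (α4 - α3)))
    (ha3 : a3 = α3 * α4 * (Φ1 α4 - Φ1 α3) / (lam1 * (α4 - α3)))
    (ha4 : a4 = (α3 * Φ1 α3 - α4 * Φ1 α4) / (lam1 * (α4 - α3)) + lam2 / (ρ + lam2)) :
    a1 < 0 ∧ a2 > 0 ∧ a3 < 0 ∧ a4 > 0 := by
  have hα4 : 0 < α4 := hα3.trans hα34
  have hd : 0 < α4 - α3 := sub_pos.2 hα34
  have hD : 0 < lam1 * (α4 - α3) := mul_pos hlam1 hd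
  have hdecr : Φ1 α4 < Φ1 α3 := by
    have h : 0 < σ1 ^ 2 * ((α4 - α3) * (α4 + α3)) := by positivity
    rw [hΦ1, hΦ1]
    linarith
  -- Vieta's formula for the sum of the roots in `α ^ 2`
  have hsum : σ1 ^ 2 * σ2 ^ 2 * (α3 ^ 2 + α4 ^ 2)
      = 2 * (ρ + lam1) * σ2 ^ 2 + 2 * (ρ + lam2) * σ1 ^ 2 := by
    have hne : (α4 - α3) * (α4 + α3) ≠ 0 := by positivity
    rw [hΦ1, hΦ2] at hroot3 hroot4
    apply mul_left_cancel₀ hne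
    linear_combination 4 * (hroot4 - hroot3)
  have hsum_gt : 2 * (ρ + lam1) < σ1 ^ 2 * (α3 ^ 2 + α4 ^ 2) := by
    have h : 0 < (ρ + lam2) * σ1 ^ 2 := by positivity
    apply lt_of_mul_lt_mul_right _ (sq_nonneg σ2)
    linarith
  refine ⟨?_, ?_, ?_, ?_⟩
  · have hlt : ρ / (ρ + lam2) < 1 := (div_lt_one (by positivity)).2 (by linarith)
    have hle : -(α4 * Φ1 α3 - α3 * Φ1 α4) / (lam1 * (α4 - α3)) ≤ -1 := by
      have h : 0 < (ρ + 1 / 2 * σ1 ^ 2 * (α3 * α4)) * (α4 - α3) := by positivity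
      rw [div_le_iff₀ hD, hΦ1, hΦ1]
      linarith
    linarith
  · rw [ha2]
    exact div_pos (sub_pos.2 hdecr) hD
  · rw [ha3]
    exact div_neg_of_neg_of_pos
      (mul_neg_of_pos_of_neg (mul_pos hα3 hα4) (sub_neg.2 hdecr)) hD
  · have hpos : 0 < lam2 / (ρ + lam2) := by positivity
    have hquot : 0 < (α3 * Φ1 α3 - α4 * Φ1 α4) / (lam1 * (α4 - α3)) := by
      apply div_pos _ hD
      have h₁ : 0 < (σ1 ^ 2 * (α3 ^ 2 + α4 ^ 2) - 2 * (ρ + lam1)) * (α4 - α3) :=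
        mul_pos (sub_pos.2 hsum_gt) hd
      have h₂ : 0 < σ1 ^ 2 * (α3 * α4) * (α4 - α3) := by positivity
      rw [hΦ1, hΦ1]
      linarith
    linarith
end

section
/- Suppose 0 < α5 ≤ 1, a2 > 0 and a1 + ρ/(α5(ρ+λ2)) ≥ 0. Then there is no pair (u,v) with u > 0 and v ≥ 0 satisfying G1(u,v) = 0. -/
theorem Real.sinh_le_mul_cosh_of_nonneg {x : ℝ} (hx : 0 ≤ x) :
    Real.sinh x ≤ x * Real.cosh x := by
  have hderiv (y : ℝ) :
      HasDerivAt (fun z => z * Real.cosh z - Real.sinh z) (y * Real.sinh y) y :=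
    (((hasDerivAt_id y).mul (Real.hasDerivAt_cosh y)).sub
      (Real.hasDerivAt_sinh y)).congr_deriv (by simp)
  have hmono : MonotoneOn (fun z => z * Real.cosh z - Real.sinh z) (Set.Ici 0) := by
    refine monotoneOn_of_deriv_nonneg (convex_Ici 0)
      (fun y _ => (hderiv y).continuousAt.continuousWithinAt)
      (fun y _ => (hderiv y).differentiableAt.differentiableWithinAt) fun y hy => ?_
    have hy0 : 0 ≤ y := interior_subset hy
    rw [(hderiv y).deriv]
    exact mul_nonneg hy0 (Real.sinh_nonneg_iff.2 hy0)
  have := hmono Set.self_mem_Ici hx hx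
  simp only [Real.sinh_zero, zero_mul, sub_zero] at this
  linarith

/-- If 0 < α5 ≤ 1, a2 > 0 and a1 + ρ/(α5(ρ+λ2)) ≥ 0, then there is
no pair (u,v) with u > 0 and v ≥ 0 satisfying G1(u,v) = 0. -/
theorem stmt_4 (ρ lam2 α5 a1 a2 : ℝ)
    (hρ : 0 < ρ) (hlam2 : 0 < lam2)
    (hα5 : 0 < α5) (hα5' : α5 ≤ 1) (ha2 : 0 < a2)
    (ha1 : a1 + ρ / (α5 * (ρ + lam2)) ≥ 0)
    (G1 : ℝ → ℝ → ℝ)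
    (hG1 : ∀ u v : ℝ, G1 u v =
      (a1 + (ρ / (α5 * (ρ + lam2))) * Real.cosh (α5 * v)) * u
        - (ρ / (α5 * (ρ + lam2))) * (Real.sinh (α5 * v) - v * Real.cosh (α5 * v))
        + a2) :
    ¬ ∃ u v : ℝ, 0 < u ∧ 0 ≤ v ∧ G1 u v = 0 := by
  rintro ⟨u, v, hu, hv, h⟩
  rw [hG1] at h
  set c := ρ / (α5 * (ρ + lam2))
  have hc : 0 < c := by positivity
  have hcosh : 1 ≤ Real.cosh (α5 * v) := Real.one_le_cosh _
  have hcoeff : 0 ≤ a1 + c * Real.cosh (α5 * v) := by nlinarith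
  have hsinh : Real.sinh (α5 * v) - v * Real.cosh (α5 * v) ≤ 0 := by
    have := Real.sinh_le_mul_cosh_of_nonneg (mul_nonneg hα5.le hv)
    have := mul_le_mul_of_nonneg_right (mul_le_of_le_one_left hv hα5')
      (Real.cosh_pos (α5 * v)).le
    linarith
  have := mul_nonneg hcoeff hu.le
  have := mul_nonpos_of_nonneg_of_nonpos hc.le hsinh
  linarith
end

section
/- Suppose 0 < α5 ≤ 1, a2 > 0 and a1 + ρ/(α5(ρ+λ2)) < 0, and let ẑ2 > 0 be the unique positive zero of v ↦ a1 + (ρ/(α5(ρ+λ2)))cosh(α5v). Then M1(v) := [(ρ/(α5(ρ+λ2)))(sinh(α5v) − v·cosh(α5v)) − a2]/(a1 + (ρ/(α5(ρ+λ2)))cosh(α5v)) is strictly increasing on [0, ẑ2), satisfies M1(v) ≥ M1(0) = −a2/(a1 + ρ/(α5(ρ+λ2))) > 0 for all v in [0, ẑ2), and M1(v) → +∞ as v ↑ ẑ2. -/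
/-- For `α ≤ 1`, the map `v ↦ sinh (α v) - v cosh (α v)` is antitone on the nonnegative reals. -/
theorem antitoneOn_sinh_sub_mul_cosh {α : ℝ} (hα : 0 ≤ α) (hα' : α ≤ 1) :
    AntitoneOn (fun v : ℝ => Real.sinh (α * v) - v * Real.cosh (α * v)) (Set.Ici 0) := by
  have hd (v : ℝ) : HasDerivAt (fun v : ℝ => Real.sinh (α * v) - v * Real.cosh (α * v))
      (Real.cosh (α * v) * α - (1 * Real.cosh (α * v) + v * (Real.sinh (α * v) * α))) v := by
    have h : HasDerivAt (fun v : ℝ => α * v) α v := by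
      simpa using (hasDerivAt_id v).const_mul α
    exact h.sinh.sub ((hasDerivAt_id v).mul h.cosh)
  refine antitoneOn_of_deriv_nonpos (convex_Ici 0)
    (fun v _ => (hd v).continuousAt.continuousWithinAt)
    (fun v _ => (hd v).differentiableAt.differentiableWithinAt) fun v hv => ?_
  rw [interior_Ici, Set.mem_Ioi] at hv
  rw [(hd v).deriv]
  have hs : 0 ≤ Real.sinh (α * v) := Real.sinh_nonneg_iff.2 (by positivity)
  have h₁ : 0 ≤ v * (Real.sinh (α * v) * α) := by positivity
  nlinarith [mul_nonneg (sub_nonneg.2 hα') (Real.cosh_pos (α * v)).le]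


/-- Under 0 < α5 ≤ 1, a2 > 0 and a1 + ρ/(α5(ρ+λ2)) < 0, with ẑ2 the
unique positive zero of v ↦ a1 + (ρ/(α5(ρ+λ2)))cosh(α5v), the function M1 is
strictly increasing on [0, ẑ2), satisfies
M1(v) ≥ M1(0) = −a2/(a1 + ρ/(α5(ρ+λ2))) > 0 there, and M1(v) → +∞ as v ↑ ẑ2. -/
theorem stmt_6 (ρ lam2 α5 a1 a2 : ℝ)
    (hρ : 0 < ρ) (hlam2 : 0 < lam2)
    (hα5 : 0 < α5) (hα5' : α5 ≤ 1) (ha2 : 0 < a2)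
    (ha1 : a1 + ρ / (α5 * (ρ + lam2)) < 0)
    (z2hat : ℝ) (hz2pos : 0 < z2hat)
    (hz2 : a1 + (ρ / (α5 * (ρ + lam2))) * Real.cosh (α5 * z2hat) = 0)
    (M1 : ℝ → ℝ)
    (hM1 : ∀ v : ℝ, M1 v =
      ((ρ / (α5 * (ρ + lam2))) * (Real.sinh (α5 * v) - v * Real.cosh (α5 * v)) - a2)
        / (a1 + (ρ / (α5 * (ρ + lam2))) * Real.cosh (α5 * v))) :
    StrictMonoOn M1 (Set.Ico (0 : ℝ) z2hat) ∧
    M1 0 = -a2 / (a1 + ρ / (α5 * (ρ + lam2))) ∧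
    0 < M1 0 ∧
    (∀ v ∈ Set.Ico (0 : ℝ) z2hat, M1 0 ≤ M1 v) ∧
    Filter.Tendsto M1 (nhdsWithin z2hat (Set.Iio z2hat)) Filter.atTop := by
  have hk : 0 < ρ / (α5 * (ρ + lam2)) := by positivity
  generalize ρ / (α5 * (ρ + lam2)) = k at *
  obtain rfl : M1 = fun v => (k * (Real.sinh (α5 * v) - v * Real.cosh (α5 * v)) - a2)
      / (a1 + k * Real.cosh (α5 * v)) := funext hM1
  clear hM1
  have hD {u v : ℝ} (hu : 0 ≤ u) (huv : u < v) :
      a1 + k * Real.cosh (α5 * u) < a1 + k * Real.cosh (α5 * v) := by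
    have hv : 0 ≤ v := hu.trans huv.le
    have : Real.cosh (α5 * u) < Real.cosh (α5 * v) := by
      rw [Real.cosh_lt_cosh, abs_of_nonneg (by positivity), abs_of_nonneg (by positivity)]
      gcongr
    gcongr
  have hN {u v : ℝ} (hu : 0 ≤ u) (huv : u ≤ v) :
      k * (Real.sinh (α5 * v) - v * Real.cosh (α5 * v)) - a2 ≤
        k * (Real.sinh (α5 * u) - u * Real.cosh (α5 * u)) - a2 := by
    have := antitoneOn_sinh_sub_mul_cosh hα5.le hα5' hu (hu.trans huv) huv
    gcongr
  have hNneg {v : ℝ} (hv : 0 ≤ v) :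
      k * (Real.sinh (α5 * v) - v * Real.cosh (α5 * v)) - a2 < 0 := by
    have := hN le_rfl hv
    simp only [mul_zero, Real.sinh_zero, zero_mul, sub_zero] at this
    linarith
  have hmono : StrictMonoOn (fun v => (k * (Real.sinh (α5 * v) - v * Real.cosh (α5 * v)) - a2)
      / (a1 + k * Real.cosh (α5 * v))) (Set.Ico 0 z2hat) := by
    rintro u ⟨hu, -⟩ v ⟨hv, hvz⟩ huv
    have hDv : a1 + k * Real.cosh (α5 * v) < 0 := hz2 ▸ hD hv hvz
    beta_reduce
    rw [← neg_div_neg_eq, ← neg_div_neg_eq (_ - _)]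
    exact div_lt_div₀' (neg_le_neg (hN hu huv.le)) (neg_lt_neg (hD hu huv))
      (neg_pos.2 (hNneg hv)) (neg_pos.2 hDv)
  refine ⟨hmono, by simp, ?_, fun v hv => hmono.monotoneOn ⟨le_rfl, hz2pos⟩ hv hv.1, ?_⟩
  · simpa using div_pos_of_neg_of_neg (neg_neg_of_pos ha2) ha1
  · have hNlim : Filter.Tendsto
        (fun v => k * (Real.sinh (α5 * v) - v * Real.cosh (α5 * v)) - a2)
        (nhdsWithin z2hat (Set.Iio z2hat))
        (nhds (k * (Real.sinh (α5 * z2hat) - z2hat * Real.cosh (α5 * z2hat)) - a2)) :=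
      (Continuous.tendsto (by fun_prop) z2hat).mono_left nhdsWithin_le_nhds
    have hDlim : Filter.Tendsto (fun v => a1 + k * Real.cosh (α5 * v))
        (nhdsWithin z2hat (Set.Iio z2hat)) (nhdsWithin 0 (Set.Iio 0)) := by
      refine tendsto_nhdsWithin_iff.2 ⟨?_, ?_⟩
      · rw [← hz2]
        exact (Continuous.tendsto (by fun_prop) z2hat).mono_left nhdsWithin_le_nhds
      · filter_upwards [Ioo_mem_nhdsLT hz2pos] with v hv
        exact hz2 ▸ hD hv.1.le hv.2
    simp only [div_eq_mul_inv]
    exact hNlim.neg_mul_atBot (hNneg hz2pos.le) (tendsto_inv_nhdsLT_zero.comp hDlim)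
end

section
/- Suppose a3 < 0, a4 > 0, a1 + ρ/(α5(ρ+λ2)) < 0 and a1 + (ρ/(α5(ρ+λ2)))cosh(1) ≥ 0, and let ẑ2 > 0 be the unique positive zero of v ↦ a1 + (ρ/(α5(ρ+λ2)))cosh(α5v). Then α5·ẑ2 ≤ 1, the function r(v) := (ρ/(ρ+λ2))[v·α5·sinh(α5v) − cosh(α5v)] − a4 satisfies r(v) < 0 for every v ∈ [0, ẑ2], and M2(v) := r(v)/(a3 − (ρα5/(ρ+λ2))sinh(α5v)) is strictly decreasing on [0, ẑ2]. -/
/-- Under a3 < 0, a4 > 0, a1 + ρ/(α5(ρ+λ2)) < 0 and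
a1 + (ρ/(α5(ρ+λ2)))cosh(1) ≥ 0, with ẑ2 the unique positive zero of
v ↦ a1 + (ρ/(α5(ρ+λ2)))cosh(α5v): one has α5·ẑ2 ≤ 1, the function
r(v) := (ρ/(ρ+λ2))[vα5 sinh(α5v) − cosh(α5v)] − a4 is negative on [0, ẑ2],
and M2 := r/(a3 − (ρα5/(ρ+λ2))sinh(α5·)) is strictly decreasing on [0, ẑ2]. -/
theorem stmt_7 (ρ lam2 α5 a1 a3 a4 : ℝ)
    (hρ : 0 < ρ) (hlam2 : 0 < lam2) (hα5 : 0 < α5)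
    (ha3 : a3 < 0) (ha4 : 0 < a4)
    (ha1 : a1 + ρ / (α5 * (ρ + lam2)) < 0)
    (ha1' : a1 + (ρ / (α5 * (ρ + lam2))) * Real.cosh 1 ≥ 0)
    (z2hat : ℝ) (hz2pos : 0 < z2hat)
    (hz2 : a1 + (ρ / (α5 * (ρ + lam2))) * Real.cosh (α5 * z2hat) = 0)
    (r M2 : ℝ → ℝ)
    (hr : ∀ v : ℝ, r v =
      (ρ / (ρ + lam2)) * (v * α5 * Real.sinh (α5 * v) - Real.cosh (α5 * v)) - a4)
    (hM2 : ∀ v : ℝ, M2 v =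
      r v / (a3 - (ρ * α5 / (ρ + lam2)) * Real.sinh (α5 * v))) :
    α5 * z2hat ≤ 1 ∧
    (∀ v ∈ Set.Icc (0 : ℝ) z2hat, r v < 0) ∧
    StrictAntiOn M2 (Set.Icc (0 : ℝ) z2hat) := by
  have hk : 0 < ρ / (ρ + lam2) := by positivity
  have hle : α5 * z2hat ≤ 1 := by
    have hc : 0 < ρ / (α5 * (ρ + lam2)) := by positivity
    have hcosh : Real.cosh (α5 * z2hat) ≤ Real.cosh 1 :=
      le_of_mul_le_mul_left (by linarith) hc
    rw [Real.cosh_le_cosh, abs_one] at hcosh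
    exact (le_abs_self _).trans hcosh
  have hden : ∀ v : ℝ, 0 ≤ v →
      a3 - (ρ * α5 / (ρ + lam2)) * Real.sinh (α5 * v) < 0 := by
    intro v hv
    have hsinh : 0 ≤ Real.sinh (α5 * v) := Real.sinh_nonneg_iff.2 (by positivity)
    have : 0 ≤ (ρ * α5 / (ρ + lam2)) * Real.sinh (α5 * v) := by positivity
    linarith
  refine ⟨hle, ?_, ?_⟩
  · rintro v ⟨hv0, hv1⟩
    have hx1 : v * α5 ≤ 1 := by nlinarith
    have hsinh : 0 ≤ Real.sinh (α5 * v) := Real.sinh_nonneg_iff.2 (by positivity)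
    have hlt := Real.sinh_lt_cosh (α5 * v)
    have hneg : v * α5 * Real.sinh (α5 * v) - Real.cosh (α5 * v) < 0 := by nlinarith
    rw [hr]
    linarith [mul_neg_of_pos_of_neg hk hneg]
  · have hderiv : ∀ v : ℝ, 0 ≤ v → HasDerivAt M2
        ((ρ / (ρ + lam2) * α5 * Real.cosh (α5 * v) *
          (α5 * v * a3 - α5 * (ρ / (ρ + lam2)) * Real.cosh (α5 * v) - α5 * a4)) /
          (a3 - (ρ * α5 / (ρ + lam2)) * Real.sinh (α5 * v)) ^ 2) v := by
      intro v hv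
      have hlin : HasDerivAt (fun v : ℝ => α5 * v) α5 v := by
        simpa using (hasDerivAt_id v).const_mul α5
      have hlin' : HasDerivAt (fun v : ℝ => v * α5) α5 v := by
        simpa using (hasDerivAt_id v).mul_const α5
      have hnum := (((hlin'.fun_mul hlin.sinh).fun_sub hlin.cosh).const_mul
        (ρ / (ρ + lam2))).sub_const a4
      have hdenom := (hlin.sinh.const_mul (ρ * α5 / (ρ + lam2))).const_sub a3
      have hquot := hnum.fun_div hdenom (hden v hv).ne
      have hM2' : M2 = fun v => ((ρ / (ρ + lam2)) *
          (v * α5 * Real.sinh (α5 * v) - Real.cosh (α5 * v)) - a4) /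
          (a3 - (ρ * α5 / (ρ + lam2)) * Real.sinh (α5 * v)) := by
        funext v
        rw [hM2, hr]
      rw [hM2']
      refine hquot.congr_deriv (congrArg (· / _) ?_)
      ring
    refine strictAntiOn_of_deriv_neg (convex_Icc 0 z2hat)
      (fun v hv => (hderiv v hv.1).continuousAt.continuousWithinAt) ?_
    intro v hv
    rw [interior_Icc] at hv
    rw [(hderiv v hv.1.le).deriv]
    have hcosh := Real.cosh_pos (α5 * v)
    have hsq := pow_pos (neg_pos.2 (hden v hv.1.le)) 2
    rw [neg_sq] at hsq
    refine div_neg_of_neg_of_pos (mul_neg_of_pos_of_neg (by positivity) ?_) hsq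
    have h1 : α5 * v * a3 < 0 := mul_neg_of_pos_of_neg (mul_pos hα5 hv.1) ha3
    have h2 : 0 < α5 * (ρ / (ρ + lam2)) * Real.cosh (α5 * v) := by positivity
    have h3 : 0 < α5 * a4 := by positivity
    linarith
end

section
/- (Proposition 2 of the paper.) Suppose Assumption A holds, and let ẑ2 be the unique positive solution of a1 + (ρ/(α5(ρ+λ2)))cosh(α5v) = 0. Then there exists a unique pair (z1*, z2*) ∈ (0,∞) × (0, ẑ2) with G1(z1*, z2*) = 0 and G2(z1*, z2*) = 0; moreover z1* satisfies −a2/(a1 + ρ/(α5(ρ+λ2))) < z1* < −(ρ/(ρ+λ2) + a4)/a3. -/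
/-- For `a ≤ 1` the function `v ↦ sinh (a v) - v cosh (a v)` is nonincreasing on `[0, ∞)`. -/
theorem antitoneOn_sinh_mul_sub_mul_cosh {a : ℝ} (ha0 : 0 < a) (ha1 : a ≤ 1) :
    AntitoneOn (fun v : ℝ => Real.sinh (a * v) - v * Real.cosh (a * v)) (Set.Ici 0) := by
  have hd : ∀ v : ℝ, HasDerivAt (fun v : ℝ => Real.sinh (a * v) - v * Real.cosh (a * v))
      ((a - 1) * Real.cosh (a * v) - a * v * Real.sinh (a * v)) v := by
    intro v
    have hl : HasDerivAt (fun v : ℝ => a * v) a v := by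
      simpa using (hasDerivAt_id v).const_mul a
    refine (hl.sinh.sub ((hasDerivAt_id v).mul hl.cosh)).congr_deriv ?_
    simp only [id]
    ring
  refine antitoneOn_of_deriv_nonpos (convex_Ici 0)
    (fun v _ => (hd v).continuousAt.continuousWithinAt)
    (fun v _ => (hd v).differentiableAt.differentiableWithinAt) fun v hv => ?_
  rw [interior_Ici, Set.mem_Ioi] at hv
  rw [(hd v).deriv]
  have h1 : 0 ≤ (1 - a) * Real.cosh (a * v) :=
    mul_nonneg (by linarith) (Real.cosh_pos _).le
  have h2 : 0 ≤ a * v * Real.sinh (a * v) :=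
    mul_nonneg (by positivity) (Real.sinh_nonneg_iff.2 (by positivity))
  linarith

/-- The function `x ↦ x sinh x - cosh x` is strictly increasing on `[0, ∞)`. -/
theorem strictMonoOn_mul_sinh_sub_cosh :
    StrictMonoOn (fun x : ℝ => x * Real.sinh x - Real.cosh x) (Set.Ici 0) := by
  have hd : ∀ x : ℝ, HasDerivAt (fun x : ℝ => x * Real.sinh x - Real.cosh x)
      (x * Real.cosh x) x := by
    intro x
    refine (((hasDerivAt_id x).mul (Real.hasDerivAt_sinh x)).sub
      (Real.hasDerivAt_cosh x)).congr_deriv ?_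
    simp only [id]
    ring
  refine strictMonoOn_of_deriv_pos (convex_Ici 0)
    (fun x _ => (hd x).continuousAt.continuousWithinAt) fun x hx => ?_
  rw [interior_Ici, Set.mem_Ioi] at hx
  rw [(hd x).deriv]
  exact mul_pos hx (Real.cosh_pos _)

/-- A positive quotient `N / D` with negative denominator grows when `N` decreases and `D`
increases. -/
theorem lt_of_mul_eq_of_lt {u u' D D' N N' : ℝ} (hu : 0 < u) (hD : D < D') (hD' : D' < 0)
    (hN : N' ≤ N) (h : u * D = N) (h' : u' * D' = N') : u < u' := by
  have : u * D < u * D' := mul_lt_mul_of_pos_left hD hu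
  by_contra! hle
  nlinarith [mul_le_mul_of_nonpos_right hle hD'.le]

/-- Two curves `D₁ u = N₁` and `D₂ u = N₂`, the first increasing to infinity and the second
decreasing on `[0, z)`, cross exactly once, at a height between their initial heights. -/
theorem existsUnique_crossing {N₁ D₁ N₂ D₂ : ℝ → ℝ} {z : ℝ} (hz : 0 < z)
    (cN₁ : Continuous N₁) (cD₁ : Continuous D₁) (cN₂ : Continuous N₂) (cD₂ : Continuous D₂)
    (mN₁ : AntitoneOn N₁ (Set.Ici 0)) (mD₁ : StrictMonoOn D₁ (Set.Ici 0))
    (mN₂ : StrictMonoOn N₂ (Set.Ici 0)) (mD₂ : StrictAntiOn D₂ (Set.Ici 0))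
    (hN₁ : N₁ 0 < 0) (hDz : D₁ z = 0) (hD₂ : D₂ 0 < 0)
    (h0 : N₁ 0 / D₁ 0 < N₂ 0 / D₂ 0) :
    (∃! p : ℝ × ℝ, 0 < p.1 ∧ 0 < p.2 ∧ p.2 < z ∧
        p.1 * D₁ p.2 = N₁ p.2 ∧ p.1 * D₂ p.2 = N₂ p.2) ∧
    (∀ p : ℝ × ℝ, (0 < p.1 ∧ 0 < p.2 ∧ p.2 < z ∧
        p.1 * D₁ p.2 = N₁ p.2 ∧ p.1 * D₂ p.2 = N₂ p.2) →
      N₁ 0 / D₁ 0 < p.1 ∧ p.1 < N₂ 0 / D₂ 0) := by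
  have nD₁ : ∀ v, 0 ≤ v → v < z → D₁ v < 0 := fun v hv hvz =>
    hDz ▸ mD₁ hv hz.le hvz
  have nD₂ : ∀ v, 0 ≤ v → D₂ v < 0 := fun v hv =>
    (mD₂.antitoneOn Set.self_mem_Ici hv hv).trans_lt hD₂
  have nN₁ : ∀ v, 0 ≤ v → N₁ v < 0 := fun v hv =>
    (mN₁ Set.self_mem_Ici hv hv).trans_lt hN₁
  have first : ∀ {u u' v w : ℝ}, 0 < u → 0 ≤ v → v < w → w < z → u * D₁ v = N₁ v →
      u' * D₁ w = N₁ w → u < u' := by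
    intro u u' v w hu hv hvw hwz h h'
    have hw : 0 ≤ w := hv.trans hvw.le
    exact lt_of_mul_eq_of_lt hu (mD₁ hv hw hvw) (nD₁ w hw hwz) (mN₁ hv hw hvw.le) h h'
  have second : ∀ {u u' v w : ℝ}, 0 < u' → 0 ≤ v → v < w → u * D₂ v = N₂ v →
      u' * D₂ w = N₂ w → u' < u := by
    intro u u' v w hu hv hvw h h'
    have hw : 0 ≤ w := hv.trans hvw.le
    exact lt_of_mul_eq_of_lt hu (mD₂ hv hw hvw) (nD₂ v hv) (mN₂ hv hw hvw).le h' h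
  have nD₁0 := nD₁ 0 le_rfl hz
  refine ⟨?_, fun p hp => ?_⟩
  · obtain ⟨v, ⟨hv0, hvz⟩, hv⟩ : ∃ v ∈ Set.Ioo 0 z, N₁ v * D₂ v - N₂ v * D₁ v = 0 := by
      refine intermediate_value_Ioo hz.le
        (f := fun v => N₁ v * D₂ v - N₂ v * D₁ v) (by fun_prop) ⟨?_, ?_⟩
      · rw [lt_div_iff_of_neg hD₂, div_mul_eq_mul_div, lt_div_iff_of_neg nD₁0] at h0
        exact sub_neg.2 h0
      · simpa [hDz] using mul_pos_of_neg_of_neg (nN₁ z hz.le) (nD₂ z hz.le)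
    have hD := nD₁ v hv0.le hvz
    have hpos : 0 < N₁ v / D₁ v := div_pos_of_neg_of_neg (nN₁ v hv0.le) hD
    have e₁ : N₁ v / D₁ v * D₁ v = N₁ v := div_mul_cancel₀ _ hD.ne
    have e₂ : N₁ v / D₁ v * D₂ v = N₂ v := by
      rw [div_mul_eq_mul_div, div_eq_iff hD.ne]
      linarith
    refine ⟨(N₁ v / D₁ v, v), ⟨hpos, hv0, hvz, e₁, e₂⟩, ?_⟩
    have unique : ∀ {u u' v w : ℝ}, 0 < u → 0 < u' → 0 ≤ v → w < z →
        u * D₁ v = N₁ v → u' * D₁ w = N₁ w → u * D₂ v = N₂ v → u' * D₂ w = N₂ w →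
        w ≤ v := by
      intro u u' v w hu hu' hv hw h₁ h₁' h₂ h₂'
      by_contra! hvw
      exact lt_asymm (first hu hv hvw hw h₁ h₁') (second hu' hv hvw h₂ h₂')
    rintro ⟨u, w⟩ ⟨hu, hw0, hwz, h₁, h₂⟩
    obtain rfl : w = v := le_antisymm
      (unique hpos hu hv0.le hwz e₁ h₁ e₂ h₂) (unique hu hpos hw0.le hvz h₁ e₁ h₂ e₂)
    exact Prod.ext (eq_div_of_mul_eq hD.ne h₁) rfl
  · obtain ⟨hu, hv0, hvz, h₁, h₂⟩ := hp
    exact ⟨first (div_pos_of_neg_of_neg hN₁ nD₁0) le_rfl hv0 hvz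
        (div_mul_cancel₀ _ nD₁0.ne) h₁,
      second hu le_rfl hv0 (div_mul_cancel₀ _ hD₂.ne) h₂⟩

/-- Proposition 2: Under Assumption A, with ẑ2 the unique positive
solution of a1 + (ρ/(α5(ρ+λ2)))cosh(α5v) = 0, there exists a unique pair
(z1*, z2*) ∈ (0,∞) × (0, ẑ2) with G1(z1*,z2*) = 0 = G2(z1*,z2*); moreover
−a2/(a1 + ρ/(α5(ρ+λ2))) < z1* < −(ρ/(ρ+λ2) + a4)/a3. -/
theorem stmt_8 (ρ lam1 lam2 σ1 σ2 : ℝ)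
    (hρ : 0 < ρ) (hlam1 : 0 < lam1) (hlam2 : 0 < lam2) (hσ1 : 0 < σ1) (hσ2 : 0 < σ2)
    (Φ1 Φ2 : ℝ → ℝ)
    (hΦ1 : ∀ α : ℝ, Φ1 α = -(1/2) * σ1^2 * α^2 + ρ + lam1)
    (hΦ2 : ∀ α : ℝ, Φ2 α = -(1/2) * σ2^2 * α^2 + ρ + lam2)
    (α3 α4 : ℝ) (hα3 : 0 < α3) (hα34 : α3 < α4)
    (hroot3 : Φ1 α3 * Φ2 α3 - lam1 * lam2 = 0)
    (hroot4 : Φ1 α4 * Φ2 α4 - lam1 * lam2 = 0)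
    (α5 : ℝ) (hα5def : α5 = Real.sqrt (2 * (ρ + lam2) / σ2^2))
    (a1 a2 a3 a4 : ℝ)
    (ha1 : a1 = -(α4 * Φ1 α3 - α3 * Φ1 α4) / (lam1 * (α4 - α3)) + ρ / (ρ + lam2))
    (ha2 : a2 = (Φ1 α3 - Φ1 α4) / (lam1 * (α4 - α3)))
    (ha3 : a3 = α3 * α4 * (Φ1 α4 - Φ1 α3) / (lam1 * (α4 - α3)))
    (ha4 : a4 = (α3 * Φ1 α3 - α4 * Φ1 α4) / (lam1 * (α4 - α3)) + lam2 / (ρ + lam2))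
    -- Assumption A
    (hA1 : α5 ≤ 1)
    (hA2 : a1 + ρ / (α5 * (ρ + lam2)) < 0)
    (hA3 : a1 + (ρ / (α5 * (ρ + lam2))) * Real.cosh 1 ≥ 0)
    (hA4 : (1 / a3) * (ρ / (ρ + lam2) + a4)
            - a2 / (a1 + ρ / (α5 * (ρ + lam2))) < 0)
    (z2hat : ℝ) (hz2pos : 0 < z2hat)
    (hz2 : a1 + (ρ / (α5 * (ρ + lam2))) * Real.cosh (α5 * z2hat) = 0)
    (G1 G2 : ℝ → ℝ → ℝ)
    (hG1 : ∀ u v : ℝ, G1 u v =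
      (a1 + (ρ / (α5 * (ρ + lam2))) * Real.cosh (α5 * v)) * u
        - (ρ / (α5 * (ρ + lam2))) * (Real.sinh (α5 * v) - v * Real.cosh (α5 * v))
        + a2)
    (hG2 : ∀ u v : ℝ, G2 u v =
      (a3 - (ρ * α5 / (ρ + lam2)) * Real.sinh (α5 * v)) * u
        - (ρ / (ρ + lam2)) * (v * α5 * Real.sinh (α5 * v) - Real.cosh (α5 * v))
        + a4) :
    (∃! p : ℝ × ℝ, 0 < p.1 ∧ 0 < p.2 ∧ p.2 < z2hat ∧
        G1 p.1 p.2 = 0 ∧ G2 p.1 p.2 = 0) ∧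
    (∀ p : ℝ × ℝ, (0 < p.1 ∧ 0 < p.2 ∧ p.2 < z2hat ∧
        G1 p.1 p.2 = 0 ∧ G2 p.1 p.2 = 0) →
      -a2 / (a1 + ρ / (α5 * (ρ + lam2))) < p.1 ∧
      p.1 < -(ρ / (ρ + lam2) + a4) / a3) := by
  have hα5 : 0 < α5 := by
    rw [hα5def]
    exact Real.sqrt_pos.2 (by positivity)
  have hα4 : 0 < α4 := hα3.trans hα34
  have hΦ : Φ1 α4 < Φ1 α3 := by
    rw [hΦ1, hΦ1]
    nlinarith [mul_lt_mul_of_pos_left (pow_lt_pow_left₀ hα34 hα3.le two_ne_zero)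
      (pow_pos hσ1 2)]
  have hden : 0 < lam1 * (α4 - α3) := mul_pos hlam1 (sub_pos.2 hα34)
  have ha2pos : 0 < a2 := by
    rw [ha2]
    exact div_pos (sub_pos.2 hΦ) hden
  have ha3neg : a3 < 0 := by
    rw [ha3]
    exact div_neg_of_neg_of_pos
      (mul_neg_of_pos_of_neg (mul_pos hα3 hα4) (sub_neg.2 hΦ)) hden
  set c := ρ / (ρ + lam2) with hc
  set k := ρ / (α5 * (ρ + lam2)) with hk
  have hcpos : 0 < c := by positivity
  have hkpos : 0 < k := by positivity
  have hcα : ρ * α5 / (ρ + lam2) = c * α5 := by rw [hc]; ring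
  have hmul : ∀ {v : ℝ}, 0 ≤ v → 0 ≤ α5 * v := fun hv => mul_nonneg hα5.le hv
  have key := existsUnique_crossing (z := z2hat)
    (N₁ := fun v => k * (Real.sinh (α5 * v) - v * Real.cosh (α5 * v)) - a2)
    (D₁ := fun v => a1 + k * Real.cosh (α5 * v))
    (N₂ := fun v => c * (α5 * v * Real.sinh (α5 * v) - Real.cosh (α5 * v)) - a4)
    (D₂ := fun v => a3 - c * α5 * Real.sinh (α5 * v)) hz2pos
    (by fun_prop) (by fun_prop) (by fun_prop) (by fun_prop)
    (fun v hv w hw hvw => sub_le_sub_right (mul_le_mul_of_nonneg_left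
      (antitoneOn_sinh_mul_sub_mul_cosh hα5 hA1 hv hw hvw) hkpos.le) _)
    (fun v hv w hw hvw => add_lt_add_right (mul_lt_mul_of_pos_left
      (Real.cosh_strictMonoOn (hmul hv) (hmul hw) (mul_lt_mul_of_pos_left hvw hα5)) hkpos) _)
    (fun v hv w hw hvw => sub_lt_sub_right (mul_lt_mul_of_pos_left
      (strictMonoOn_mul_sinh_sub_cosh (hmul hv) (hmul hw)
        (mul_lt_mul_of_pos_left hvw hα5)) hcpos) _)
    (fun v hv w hw hvw => sub_lt_sub_left (mul_lt_mul_of_pos_left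
      (Real.sinh_strictMono (mul_lt_mul_of_pos_left hvw hα5)) (mul_pos hcpos hα5)) _)
    (by simpa using ha2pos) hz2 (by simpa using ha3neg)
    (by
      have e₁ : (-c - a4) / a3 = -(1 / a3 * (c + a4)) := by ring
      have e₂ : -a2 / (a1 + k) = -(a2 / (a1 + k)) := neg_div _ _
      simp only [mul_zero, Real.sinh_zero, Real.cosh_zero, sub_zero, zero_sub,
        mul_one, mul_neg]
      rw [e₁, e₂]
      linarith)
  have iG1 : ∀ u v, G1 u v = 0 ↔ u * (a1 + k * Real.cosh (α5 * v)) =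
      k * (Real.sinh (α5 * v) - v * Real.cosh (α5 * v)) - a2 := by
    intro u v
    rw [hG1]
    constructor <;> intro h <;> linarith
  have iG2 : ∀ u v, G2 u v = 0 ↔ u * (a3 - c * α5 * Real.sinh (α5 * v)) =
      c * (α5 * v * Real.sinh (α5 * v) - Real.cosh (α5 * v)) - a4 := by
    intro u v
    rw [hG2, hcα]
    constructor <;> intro h <;> linarith
  have e : -(c + a4) / a3 = (-c - a4) / a3 := by ring
  simp only [iG1, iG2, e]
  simpa using key
end

section
/- Suppose a1 + ρ/(α5(ρ+λ2)) < 0. Then the inequality 1/α4 ≤ −a2/(a1 + ρ/(α5(ρ+λ2))) holds if and only if Φ1(α4) ≤ (ρλ1/(ρ+λ2))(1 + α5); moreover, this latter inequality is always satisfied (since Φ1(α4) < 0), so that 1/α4 ≤ −a2/(a1 + ρ/(α5(ρ+λ2))) holds. -/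
/-- If two strictly decreasing quantities have the same positive product at two points, then at the
later point the first one is negative. -/
theorem neg_of_mul_eq_mul_of_lt {p q p' q' : ℝ} (hp : p' < p) (hq : q' < q)
    (hpos : 0 < p' * q') (h : p * q = p' * q') : p' < 0 := by
  by_contra! hp'
  have hq' : 0 < q' := pos_of_mul_pos_right hpos hp'
  exact (mul_lt_mul'' hp hq hp' hq'.le).ne' h

/-- Assuming a1 + ρ/(α5(ρ+λ2)) < 0: the inequality
1/α4 ≤ −a2/(a1 + ρ/(α5(ρ+λ2))) holds iff Φ1(α4) ≤ (ρλ1/(ρ+λ2))(1 + α5);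
moreover Φ1(α4) < 0, so the inequality always holds. -/
theorem stmt_11 (ρ lam1 lam2 σ1 σ2 : ℝ)
    (hρ : 0 < ρ) (hlam1 : 0 < lam1) (hlam2 : 0 < lam2) (hσ1 : 0 < σ1) (hσ2 : 0 < σ2)
    (Φ1 Φ2 : ℝ → ℝ)
    (hΦ1 : ∀ α : ℝ, Φ1 α = -(1/2) * σ1^2 * α^2 + ρ + lam1)
    (hΦ2 : ∀ α : ℝ, Φ2 α = -(1/2) * σ2^2 * α^2 + ρ + lam2)
    (α3 α4 : ℝ) (hα3 : 0 < α3) (hα34 : α3 < α4)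
    (hroot3 : Φ1 α3 * Φ2 α3 - lam1 * lam2 = 0)
    (hroot4 : Φ1 α4 * Φ2 α4 - lam1 * lam2 = 0)
    (α5 : ℝ) (hα5def : α5 = Real.sqrt (2 * (ρ + lam2) / σ2^2))
    (a1 a2 : ℝ)
    (ha1 : a1 = -(α4 * Φ1 α3 - α3 * Φ1 α4) / (lam1 * (α4 - α3)) + ρ / (ρ + lam2))
    (ha2 : a2 = (Φ1 α3 - Φ1 α4) / (lam1 * (α4 - α3)))
    (hneg : a1 + ρ / (α5 * (ρ + lam2)) < 0) :
    (1 / α4 ≤ -a2 / (a1 + ρ / (α5 * (ρ + lam2))) ↔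
      Φ1 α4 ≤ (ρ * lam1 / (ρ + lam2)) * (1 + α5)) ∧
    Φ1 α4 < 0 ∧
    1 / α4 ≤ -a2 / (a1 + ρ / (α5 * (ρ + lam2))) := by
  have hsq : α3 ^ 2 < α4 ^ 2 := by gcongr
  have hΦ4 : Φ1 α4 < 0 := by
    refine neg_of_mul_eq_mul_of_lt (p := Φ1 α3) (q := Φ2 α3) (q' := Φ2 α4) ?_ ?_ ?_ ?_
    · have := mul_lt_mul_of_pos_left hsq (pow_pos hσ1 2)
      rw [hΦ1, hΦ1]
      linarith
    · have := mul_lt_mul_of_pos_left hsq (pow_pos hσ2 2)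
      rw [hΦ2, hΦ2]
      linarith
    · rw [sub_eq_zero.mp hroot4]
      positivity
    · linarith
  have hα5 : 0 ≤ α5 := hα5def ▸ Real.sqrt_nonneg _
  have hα4 : 0 < α4 := hα3.trans hα34
  have hbound : Φ1 α4 ≤ (ρ * lam1 / (ρ + lam2)) * (1 + α5) := hΦ4.le.trans (by positivity)
  have hsum : a1 + α4 * a2 = -Φ1 α4 / lam1 + ρ / (ρ + lam2) := by
    have hsub : α4 - α3 ≠ 0 := (sub_pos.mpr hα34).ne'
    rw [ha1, ha2]
    field_simp
    ring
  have hineq : 1 / α4 ≤ -a2 / (a1 + ρ / (α5 * (ρ + lam2))) := by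
    have hfirst : 0 < -Φ1 α4 / lam1 := div_pos (neg_pos.mpr hΦ4) hlam1
    have hsecond : 0 < ρ / (ρ + lam2) := by positivity
    have hthird : 0 ≤ ρ / (α5 * (ρ + lam2)) := by positivity
    rw [le_div_iff_of_neg hneg, one_div, ← div_eq_inv_mul, le_div_iff₀ hα4]
    linarith
  exact ⟨iff_of_true hineq hbound, hΦ4, hineq⟩
end

section
/- Let 0 < α3 < α4, let x1 ∈ ℝ, and let z be a real number with 1/α4 ≤ z ≤ 1/α3 + 1/α4. Define A3 := [(α4z − 1)/(α4 − α3)]·e^{−α3x1} and A4 := [(1 − α3z)/(α4 − α3)]·e^{−α4x1}. Then the function g(x) := A3·e^{α3x} + A4·e^{α4x} satisfies g''(x) ≥ 0 for every x ≤ x1; in particular g is convex on (−∞, x1]. -/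
/-- The derivative of a two-term exponential sum is again a two-term exponential sum. -/
lemma hasDerivAt_exp_sum (a b c d x : ℝ) :
    HasDerivAt (fun x => c * Real.exp (a * x) + d * Real.exp (b * x))
      (c * a * Real.exp (a * x) + d * b * Real.exp (b * x)) x := by
  have h (k : ℝ) : HasDerivAt (fun x => Real.exp (k * x)) (Real.exp (k * x) * k) x := by
    simpa using ((hasDerivAt_id x).const_mul k).exp
  exact (((h a).const_mul c).add ((h b).const_mul d)).congr_deriv (by ring)

/-- Let 0 < α3 < α4, x1 ∈ ℝ, and 1/α4 ≤ z ≤ 1/α3 + 1/α4. With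
A3 := [(α4z − 1)/(α4 − α3)]e^{−α3x1} and A4 := [(1 − α3z)/(α4 − α3)]e^{−α4x1},
the function g(x) := A3e^{α3x} + A4e^{α4x} has nonnegative second derivative on
(−∞, x1]; in particular g is convex there. -/
theorem stmt_12 (α3 α4 x1 z : ℝ)
    (hα3 : 0 < α3) (hα34 : α3 < α4)
    (hz1 : 1 / α4 ≤ z) (hz2 : z ≤ 1 / α3 + 1 / α4)
    (A3 A4 : ℝ)
    (hA3 : A3 = ((α4 * z - 1) / (α4 - α3)) * Real.exp (-α3 * x1))
    (hA4 : A4 = ((1 - α3 * z) / (α4 - α3)) * Real.exp (-α4 * x1))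
    (g : ℝ → ℝ)
    (hg : ∀ x : ℝ, g x = A3 * Real.exp (α3 * x) + A4 * Real.exp (α4 * x)) :
    (∀ x : ℝ, x ≤ x1 → 0 ≤ deriv (deriv g) x) ∧
    ConvexOn ℝ (Set.Iic x1) g := by
  have hα4 : 0 < α4 := hα3.trans hα34
  have hsub : 0 < α4 - α3 := sub_pos.mpr hα34
  have hz1' : 0 ≤ α4 * z - 1 := by
    rw [div_le_iff₀ hα4] at hz1
    linarith
  have hz2' : 0 ≤ α3 + α4 - α3 * α4 * z := by
    have h := mul_le_mul_of_nonneg_left hz2 (mul_pos hα3 hα4).le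
    have e : α3 * α4 * (1 / α3 + 1 / α4) = α3 + α4 := by
      field_simp
      ring
    linarith
  obtain rfl : g = fun x => A3 * Real.exp (α3 * x) + A4 * Real.exp (α4 * x) := funext hg
  have hd1 : deriv (fun x => A3 * Real.exp (α3 * x) + A4 * Real.exp (α4 * x)) =
      fun x => A3 * α3 * Real.exp (α3 * x) + A4 * α4 * Real.exp (α4 * x) :=
    funext fun x => (hasDerivAt_exp_sum α3 α4 A3 A4 x).deriv
  have hnonneg : ∀ x : ℝ, x ≤ x1 →
      0 ≤ deriv (deriv fun x => A3 * Real.exp (α3 * x) + A4 * Real.exp (α4 * x)) x := by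
    intro x hx
    rw [hd1, (hasDerivAt_exp_sum α3 α4 (A3 * α3) (A4 * α4) x).deriv]
    have hle : Real.exp (α4 * (x - x1)) ≤ Real.exp (α3 * (x - x1)) :=
      Real.exp_le_exp.mpr (mul_le_mul_of_nonpos_right hα34.le (sub_nonpos.mpr hx))
    have hexp (k : ℝ) : Real.exp (-k * x1) * Real.exp (k * x) = Real.exp (k * (x - x1)) := by
      rw [← Real.exp_add]
      ring_nf
    have key : A3 * α3 * α3 * Real.exp (α3 * x) + A4 * α4 * α4 * Real.exp (α4 * x) =
        (α4 * z - 1) / (α4 - α3) * α3 ^ 2 *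
          (Real.exp (α3 * (x - x1)) - Real.exp (α4 * (x - x1))) +
        (α3 + α4 - α3 * α4 * z) * Real.exp (α4 * (x - x1)) := by
      rw [hA3, hA4, ← hexp α3, ← hexp α4]
      field_simp
      ring
    rw [key]
    have := sub_nonneg.mpr hle
    positivity
  refine ⟨hnonneg, convexOn_of_deriv2_nonneg' (convex_Iic x1) ?_ ?_ fun x hx => hnonneg x hx⟩
  · exact fun x _ => (hasDerivAt_exp_sum α3 α4 A3 A4 x).differentiableAt.differentiableWithinAt
  · rw [hd1]
    exact fun x _ =>
      (hasDerivAt_exp_sum α3 α4 (A3 * α3) (A4 * α4) x).differentiableAt.differentiableWithinAt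
end

section
/- Suppose a1 + ρ/(α5(ρ+λ2)) < 0. Then the inequality σ1²(α3+α4)/(σ1²α3α4 + 2ρ) ≤ −a2/(a1 + ρ/(α5(ρ+λ2))) holds if and only if α5 ≤ ρ/λ2. Moreover, the inequality −(ρ/(ρ+λ2) + a4)/a3 ≤ (2λ1/(α3α4σ1²(α3+α4)))·[1 + (α3Φ1(α3) − α4Φ1(α4))/(λ1(α4−α3))] is always satisfied. -/
/-- Assuming a1 + ρ/(α5(ρ+λ2)) < 0: the inequality
σ1²(α3+α4)/(σ1²α3α4 + 2ρ) ≤ −a2/(a1 + ρ/(α5(ρ+λ2))) holds iff α5 ≤ ρ/λ2;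
moreover −(ρ/(ρ+λ2) + a4)/a3 ≤ (2λ1/(α3α4σ1²(α3+α4)))·
[1 + (α3Φ1(α3) − α4Φ1(α4))/(λ1(α4−α3))] always holds. -/
theorem stmt_13 (ρ lam1 lam2 σ1 σ2 : ℝ)
    (hρ : 0 < ρ) (hlam1 : 0 < lam1) (hlam2 : 0 < lam2) (hσ1 : 0 < σ1) (hσ2 : 0 < σ2)
    (Φ1 Φ2 : ℝ → ℝ)
    (hΦ1 : ∀ α : ℝ, Φ1 α = -(1/2) * σ1^2 * α^2 + ρ + lam1)
    (hΦ2 : ∀ α : ℝ, Φ2 α = -(1/2) * σ2^2 * α^2 + ρ + lam2)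
    (α3 α4 : ℝ) (hα3 : 0 < α3) (hα34 : α3 < α4)
    (hroot3 : Φ1 α3 * Φ2 α3 - lam1 * lam2 = 0)
    (hroot4 : Φ1 α4 * Φ2 α4 - lam1 * lam2 = 0)
    (α5 : ℝ) (hα5def : α5 = Real.sqrt (2 * (ρ + lam2) / σ2^2))
    (a1 a2 a3 a4 : ℝ)
    (ha1 : a1 = -(α4 * Φ1 α3 - α3 * Φ1 α4) / (lam1 * (α4 - α3)) + ρ / (ρ + lam2))
    (ha2 : a2 = (Φ1 α3 - Φ1 α4) / (lam1 * (α4 - α3)))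
    (ha3 : a3 = α3 * α4 * (Φ1 α4 - Φ1 α3) / (lam1 * (α4 - α3)))
    (ha4 : a4 = (α3 * Φ1 α3 - α4 * Φ1 α4) / (lam1 * (α4 - α3)) + lam2 / (ρ + lam2))
    (hneg : a1 + ρ / (α5 * (ρ + lam2)) < 0) :
    (σ1^2 * (α3 + α4) / (σ1^2 * α3 * α4 + 2 * ρ) ≤
        -a2 / (a1 + ρ / (α5 * (ρ + lam2))) ↔ α5 ≤ ρ / lam2) ∧
    -(ρ / (ρ + lam2) + a4) / a3 ≤
      (2 * lam1 / (α3 * α4 * σ1^2 * (α3 + α4))) *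
        (1 + (α3 * Φ1 α3 - α4 * Φ1 α4) / (lam1 * (α4 - α3))) := by
  have hα4 : 0 < α4 := hα3.trans hα34
  have hd : α4 - α3 ≠ 0 := (sub_pos.mpr hα34).ne'
  have hα5 : 0 < α5 := by rw [hα5def]; positivity
  have hS : 0 < σ1^2 * (α3 + α4) := by positivity
  have ha2' : a2 = σ1^2 * (α3 + α4) / (2 * lam1) := by
    rw [ha2, hΦ1, hΦ1]; field_simp; ring
  have ha1' : a1 = -(ρ + lam1 + σ1^2 * α3 * α4 / 2) / lam1 + ρ / (ρ + lam2) := by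
    rw [ha1, hΦ1, hΦ1]; field_simp; ring
  have ha3' : a3 = -(α3 * α4 * σ1^2 * (α3 + α4) / (2 * lam1)) := by
    rw [ha3, hΦ1, hΦ1]; field_simp; ring
  constructor
  · have hgap : 2 * lam1 * -(a1 + ρ / (α5 * (ρ + lam2))) - (σ1^2 * α3 * α4 + 2 * ρ) =
        2 * lam1 * (α5 * lam2 - ρ) / (α5 * (ρ + lam2)) := by
      rw [ha1']; field_simp; ring
    have hrhs : -a2 / (a1 + ρ / (α5 * (ρ + lam2))) =
        σ1^2 * (α3 + α4) / (2 * lam1 * -(a1 + ρ / (α5 * (ρ + lam2)))) := by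
      have hne := hneg.ne
      generalize a1 + ρ / (α5 * (ρ + lam2)) = D at hne ⊢
      rw [ha2']; field_simp
    have hD : 0 < 2 * lam1 * -(a1 + ρ / (α5 * (ρ + lam2))) :=
      mul_pos (by positivity) (neg_pos.mpr hneg)
    rw [hrhs, div_le_div_iff_of_pos_left hS (by positivity) hD, ← sub_nonpos, hgap,
      div_le_iff₀ (by positivity), zero_mul, le_div_iff₀ hlam2, ← sub_nonpos (b := ρ)]
    have hl : 0 < 2 * lam1 := by positivity
    exact ⟨fun h => nonpos_of_mul_nonpos_right h hl, mul_nonpos_of_nonneg_of_nonpos hl.le⟩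
  · apply le_of_eq
    have hsum : ρ / (ρ + lam2) + a4 =
        1 + (α3 * Φ1 α3 - α4 * Φ1 α4) / (lam1 * (α4 - α3)) := by
      rw [ha4]; field_simp; ring
    rw [hsum, ha3', neg_div_neg_eq]
    field_simp
end

section
/- Let x1 ∈ ℝ and ĉ ∈ ℝ, and set z := x1 − ĉ. Suppose σ1²(α3+α4)/(σ1²α3α4 + 2ρ) ≤ z ≤ (2λ1/(α3α4σ1²(α3+α4)))·[1 + (α3Φ1(α3) − α4Φ1(α4))/(λ1(α4−α3))]. Define A3 := [(α4z − 1)/(α4−α3)]e^{−α3x1}, A4 := [(1 − α3z)/(α4−α3)]e^{−α4x1}, B3 := (Φ1(α3)/λ1)A3 and B4 := (Φ1(α4)/λ1)A4. Then B3e^{α3x1} + B4e^{α4x1} ≥ x1 − ĉ and α3B3e^{α3x1} + α4B4e^{α4x1} ≤ 1; equivalently, B3e^{α3x1} + B4e^{α4x1} = [−(1/2)σ1²(α3+α4) + z((1/2)σ1²α3α4 + ρ + λ1)]/λ1 ≥ z and α3B3e^{α3x1} + α4B4e^{α4x1} = (α4Φ1(α4) − α3Φ1(α3))/(λ1(α4−α3))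 + α3α4σ1²z(α3+α4)/(2λ1) ≤ 1. -/
/-- With z := x1 − ĉ satisfying the two-sided bound, and
A3, A4, B3, B4 defined as in the paper, one has
B3e^{α3x1} + B4e^{α4x1} ≥ x1 − ĉ and α3B3e^{α3x1} + α4B4e^{α4x1} ≤ 1, together
with the two closed-form identities. -/
theorem stmt_14 (ρ lam1 lam2 σ1 σ2 : ℝ)
    (hρ : 0 < ρ) (hlam1 : 0 < lam1) (hlam2 : 0 < lam2) (hσ1 : 0 < σ1) (hσ2 : 0 < σ2)
    (Φ1 Φ2 : ℝ → ℝ)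
    (hΦ1 : ∀ α : ℝ, Φ1 α = -(1/2) * σ1^2 * α^2 + ρ + lam1)
    (hΦ2 : ∀ α : ℝ, Φ2 α = -(1/2) * σ2^2 * α^2 + ρ + lam2)
    (α3 α4 : ℝ) (hα3 : 0 < α3) (hα34 : α3 < α4)
    (hroot3 : Φ1 α3 * Φ2 α3 - lam1 * lam2 = 0)
    (hroot4 : Φ1 α4 * Φ2 α4 - lam1 * lam2 = 0)
    (x1 chat z : ℝ) (hz : z = x1 - chat)
    (hlow : σ1^2 * (α3 + α4) / (σ1^2 * α3 * α4 + 2 * ρ) ≤ z)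
    (hhigh : z ≤ (2 * lam1 / (α3 * α4 * σ1^2 * (α3 + α4))) *
        (1 + (α3 * Φ1 α3 - α4 * Φ1 α4) / (lam1 * (α4 - α3))))
    (A3 A4 B3 B4 : ℝ)
    (hA3 : A3 = ((α4 * z - 1) / (α4 - α3)) * Real.exp (-α3 * x1))
    (hA4 : A4 = ((1 - α3 * z) / (α4 - α3)) * Real.exp (-α4 * x1))
    (hB3 : B3 = (Φ1 α3 / lam1) * A3)
    (hB4 : B4 = (Φ1 α4 / lam1) * A4) :
    B3 * Real.exp (α3 * x1) + B4 * Real.exp (α4 * x1) ≥ x1 - chat ∧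
    α3 * B3 * Real.exp (α3 * x1) + α4 * B4 * Real.exp (α4 * x1) ≤ 1 ∧
    B3 * Real.exp (α3 * x1) + B4 * Real.exp (α4 * x1) =
      (-(1/2) * σ1^2 * (α3 + α4) + z * ((1/2) * σ1^2 * α3 * α4 + ρ + lam1)) / lam1 ∧
    α3 * B3 * Real.exp (α3 * x1) + α4 * B4 * Real.exp (α4 * x1) =
      (α4 * Φ1 α4 - α3 * Φ1 α3) / (lam1 * (α4 - α3)) +
        α3 * α4 * σ1^2 * z * (α3 + α4) / (2 * lam1) := by
  have hd : 0 < α4 - α3 := sub_pos.mpr hα34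
  have hα4 : 0 < α4 := hα3.trans hα34
  have he3 : Real.exp (-α3 * x1) * Real.exp (α3 * x1) = 1 := by
    rw [← Real.exp_add]; simp
  have he4 : Real.exp (-α4 * x1) * Real.exp (α4 * x1) = 1 := by
    rw [← Real.exp_add]; simp
  have hB3e : B3 * Real.exp (α3 * x1) = Φ1 α3 / lam1 * ((α4 * z - 1) / (α4 - α3)) := by
    rw [hB3, hA3]
    linear_combination Φ1 α3 / lam1 * ((α4 * z - 1) / (α4 - α3)) * he3
  have hB4e : B4 * Real.exp (α4 * x1) = Φ1 α4 / lam1 * ((1 - α3 * z) / (α4 - α3)) := by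
    rw [hB4, hA4]
    linear_combination Φ1 α4 / lam1 * ((1 - α3 * z) / (α4 - α3)) * he4
  have hvalue : B3 * Real.exp (α3 * x1) + B4 * Real.exp (α4 * x1) =
      (-(1/2) * σ1^2 * (α3 + α4) + z * ((1/2) * σ1^2 * α3 * α4 + ρ + lam1)) / lam1 := by
    rw [hB3e, hB4e, hΦ1, hΦ1]
    field_simp
    ring
  have hslope : α3 * B3 * Real.exp (α3 * x1) + α4 * B4 * Real.exp (α4 * x1) =
      (α4 * Φ1 α4 - α3 * Φ1 α3) / (lam1 * (α4 - α3)) +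
        α3 * α4 * σ1^2 * z * (α3 + α4) / (2 * lam1) := by
    rw [mul_assoc α3, mul_assoc α4 B4, hB3e, hB4e, hΦ1, hΦ1]
    field_simp
    ring
  refine ⟨?_, ?_, hvalue, hslope⟩
  · rw [hvalue, ← hz, ge_iff_le, le_div_iff₀ hlam1]
    rw [div_le_iff₀ (by positivity)] at hlow
    linarith
  · rw [hslope]
    have hP : 0 < α3 * α4 * σ1^2 * (α3 + α4) := by positivity
    rw [div_mul_eq_mul_div, le_div_iff₀ hP] at hhigh
    have hbound : α3 * α4 * σ1^2 * z * (α3 + α4) / (2 * lam1) ≤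
        1 + (α3 * Φ1 α3 - α4 * Φ1 α4) / (lam1 * (α4 - α3)) := by
      rw [div_le_iff₀ (by positivity)]
      linarith
    have hneg : (α4 * Φ1 α4 - α3 * Φ1 α3) / (lam1 * (α4 - α3)) =
        -((α3 * Φ1 α3 - α4 * Φ1 α4) / (lam1 * (α4 - α3))) := by
      rw [← neg_div, neg_sub]
    linarith
end

section
/- The consistency identity (1/2)σ1²(α3+α4)/(ρ + (1/2)σ1²α3α4) = [(1/2)σ1²(α3² + α4² + α3α4) − ρ]/[(1/2)σ1²α3α4(α3+α4)] holds if and only if σ1 = σ2. -/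
/-- If `z` is a root of the quartic in the variable `z = α²`, and `(1/2)σ1² z = ρ`, then the two
volatilities agree. -/
theorem eq_of_root_of_half_sq_mul_eq {ρ l1 l2 σ1 σ2 z : ℝ} (hρ : 0 < ρ) (hl1 : 0 < l1)
    (hσ1 : 0 < σ1) (hσ2 : 0 < σ2)
    (hroot : (-(1/2) * σ1^2 * z + ρ + l1) * (-(1/2) * σ2^2 * z + ρ + l2) - l1 * l2 = 0)
    (hz : (1/2) * σ1^2 * z = ρ) : σ1 = σ2 := by
  have h1 : -(1/2) * σ1^2 * z + ρ + l1 = l1 := by linarith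
  rw [h1] at hroot
  have h2 : l1 * (ρ - (1/2) * σ2^2 * z) = 0 := by linear_combination hroot
  have h3 := (mul_eq_zero.mp h2).resolve_left hl1.ne'
  have hz0 : z ≠ 0 := by
    rintro rfl
    simp at hz
    exact hρ.ne hz
  have h4 : σ1^2 = σ2^2 := mul_right_cancel₀ hz0 (by linarith)
  exact (sq_eq_sq₀ hσ1.le hσ2.le).mp h4

/-- The consistency identity says exactly that `(1/2)σ² α² = ρ` for `α = x` or `α = y`. -/
theorem consistency_iff {ρ σ x y : ℝ} (hρ : 0 < ρ) (hσ : 0 < σ) (hx : 0 < x) (hy : 0 < y) :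
    (1/2) * σ^2 * (x + y) / (ρ + (1/2) * σ^2 * x * y) =
      ((1/2) * σ^2 * (x^2 + y^2 + x * y) - ρ) / ((1/2) * σ^2 * x * y * (x + y)) ↔
    (1/2) * σ^2 * x^2 = ρ ∨ (1/2) * σ^2 * y^2 = ρ := by
  rw [div_eq_div_iff (by positivity) (by positivity), ← sub_eq_zero,
    ← sub_eq_zero (a := (1/2) * σ^2 * x^2), ← sub_eq_zero (a := (1/2) * σ^2 * y^2), ← mul_eq_zero]
  constructor <;> intro h <;> linear_combination h

/-- The consistency identity
(1/2)σ1²(α3+α4)/(ρ + (1/2)σ1²α3α4)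
  = [(1/2)σ1²(α3² + α4² + α3α4) − ρ]/[(1/2)σ1²α3α4(α3+α4)]
holds if and only if σ1 = σ2. -/
theorem stmt_16 (ρ lam1 lam2 σ1 σ2 : ℝ)
    (hρ : 0 < ρ) (hlam1 : 0 < lam1) (hlam2 : 0 < lam2) (hσ1 : 0 < σ1) (hσ2 : 0 < σ2)
    (Φ1 Φ2 : ℝ → ℝ)
    (hΦ1 : ∀ α : ℝ, Φ1 α = -(1/2) * σ1^2 * α^2 + ρ + lam1)
    (hΦ2 : ∀ α : ℝ, Φ2 α = -(1/2) * σ2^2 * α^2 + ρ + lam2)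
    (α3 α4 : ℝ) (hα3 : 0 < α3) (hα34 : α3 < α4)
    (hroot3 : Φ1 α3 * Φ2 α3 - lam1 * lam2 = 0)
    (hroot4 : Φ1 α4 * Φ2 α4 - lam1 * lam2 = 0) :
    (1/2) * σ1^2 * (α3 + α4) / (ρ + (1/2) * σ1^2 * α3 * α4) =
      ((1/2) * σ1^2 * (α3^2 + α4^2 + α3 * α4) - ρ) /
        ((1/2) * σ1^2 * α3 * α4 * (α3 + α4)) ↔ σ1 = σ2 := by
  simp only [hΦ1, hΦ2] at hroot3 hroot4
  rw [consistency_iff hρ hσ1 hα3 (hα3.trans hα34)]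
  constructor
  · rintro (h | h)
    · exact eq_of_root_of_half_sq_mul_eq hρ hlam1 hσ1 hσ2 hroot3 h
    · exact eq_of_root_of_half_sq_mul_eq hρ hlam1 hσ1 hσ2 hroot4 h
  · rintro rfl
    have factor {z : ℝ} (hz : (-(1/2) * σ1^2 * z + ρ + lam1) *
        (-(1/2) * σ1^2 * z + ρ + lam2) - lam1 * lam2 = 0) :
        (1/2) * σ1^2 * z = ρ ∨ (1/2) * σ1^2 * z = ρ + lam1 + lam2 := by
      rw [← sub_eq_zero, ← sub_eq_zero (b := ρ + lam1 + lam2), ← mul_eq_zero]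
      linear_combination hz
    have hlt : (1/2) * σ1^2 * α3^2 < (1/2) * σ1^2 * α4^2 := by gcongr
    rcases factor hroot3 with h3 | h3
    · exact Or.inl h3
    · exact Or.inr ((factor hroot4).resolve_right fun h4 => by linarith)
end
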